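/- arXiv:2009.01301 — 2 statements merged into one kernel-verified Lean document; each statement's English description precedes it below -/
import Mathlib

section
/- A finite abelian group G has property L if and only if G is cyclic of order 2^n or cyclic of order 3·2^n for some integer n ≥ 0. -/
/-- The natural reduction ring homomorphism `W₂(k) → k` from length-two `p`-typical
Witt vectors to `k`, given by the zeroth coefficient. -/
noncomputable def wittReduce (p : ℕ) [Fact p.Prime] (k : Type*) [CommRing k] :
    TruncatedWittVector p 2 k →+* k :=
  RingHom.liftOfRightInverse (WittVector.truncate 2) TruncatedWittVector.out
    TruncatedWittVector.truncateFun_out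
    ⟨WittVector.constantCoeff, fun x hx => by
      rw [WittVector.mem_ker_truncate] at hx
      simpa [RingHom.mem_ker] using hx 0 (by norm_num)⟩

/-- A finite group `G` has property `L_p` if every homomorphism `G → GL_n(k)`, for `k` a
finite field of characteristic `p`, lifts to `GL_n(W₂(k))`. -/
def HasLp (p : ℕ) [Fact p.Prime] (G : Type*) [Group G] : Prop :=
  ∀ (n : ℕ), 1 ≤ n → ∀ (k : Type) [Field k] [Fintype k] [CharP k p],
    ∀ f : G →* GL (Fin n) k,
      ∃ g : G →* GL (Fin n) (TruncatedWittVector p 2 k),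
        (Matrix.GeneralLinearGroup.map (wittReduce p k)).comp g = f

/-- A group has property `L` if it has property `L_p` for every prime `p`. -/
def HasL (G : Type*) [Group G] : Prop :=
  ∀ (p : ℕ) [Fact p.Prime], HasLp p G

/-- A ring homomorphism that looks like reduction modulo `p` on a flat `ℤ/p²`-algebra: it is
surjective, and both its kernel and the annihilator of `p` are equal to `pR`. -/
structure IsModPReduction (p : ℕ) {R S : Type*} [Ring R] [Ring S] (φ : R →+* S) : Prop where
  surjective : Function.Surjective φ
  eq_zero_iff_exists : ∀ x, φ x = 0 ↔ ∃ y, x = (p : R) * y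
  mul_eq_zero_iff : ∀ x, (p : R) * x = 0 ↔ φ x = 0

namespace IsModPReduction

section Ring

variable {p : ℕ} {R S : Type*} [Ring R] [Ring S] {φ : R →+* S}

theorem map_mul_eq_zero (h : IsModPReduction p φ) (y : R) : φ ((p : R) * y) = 0 :=
  (h.eq_zero_iff_exists _).2 ⟨y, rfl⟩

theorem mul_mul_eq_zero (h : IsModPReduction p φ) (y : R) : (p : R) * ((p : R) * y) = 0 :=
  (h.mul_eq_zero_iff _).2 (h.map_mul_eq_zero y)

theorem exists_eq_add (h : IsModPReduction p φ) (x y : R) (hxy : φ x = φ y) :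
    ∃ z, x = y + (p : R) * z := by
  obtain ⟨z, hz⟩ := (h.eq_zero_iff_exists (x - y)).1 (by rw [map_sub, hxy, sub_self])
  exact ⟨z, by rw [← hz]; abel⟩

theorem mul_eq_mul (h : IsModPReduction p φ) (x y : R) (hxy : φ x = φ y) : (p : R) * x = p * y := by
  rw [← sub_eq_zero, ← mul_sub, h.mul_eq_zero_iff, map_sub, hxy, sub_self]

/-- Commuting elements with the same reduction have the same `p`-th power. -/
theorem pow_eq_pow (h : IsModPReduction p φ) {x y : R} (hxy : Commute x y)
    (hφ : φ x = φ y) : x ^ p = y ^ p := by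
  obtain ⟨z, hz⟩ := h.exists_eq_add x y hφ
  have hcomm : Commute y ((p : R) * z) := by
    have : (p : R) * z = x - y := by rw [hz]; abel
    rw [this]
    exact hxy.symm.sub_right (Commute.refl y)
  have hsq : (p : R) * z * ((p : R) * z) = 0 := by
    rw [mul_assoc, ← mul_assoc z, ← (Nat.cast_commute p z).eq, mul_assoc, h.mul_mul_eq_zero]
  have key : ∀ n : ℕ, (y + (p : R) * z) ^ n = y ^ n + (n : R) * (y ^ (n - 1) * ((p : R) * z)) := by
    intro n
    induction n with
    | zero => simp
    | succ n ih =>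
      rw [pow_succ, ih]
      rcases n with _ | n
      · simp
      · have e : y ^ n * ((p : R) * z) * y = y ^ (n + 1) * ((p : R) * z) := by
          rw [mul_assoc, ← hcomm.eq, ← mul_assoc, ← pow_succ]
        rw [Nat.add_sub_cancel, add_mul, mul_add, mul_add, mul_assoc _ _ y, e, mul_assoc _ _ (_ * z),
          mul_assoc _ _ (_ * z), hsq, mul_zero, mul_zero, add_zero, ← pow_succ,
          Nat.cast_succ (n + 1), add_mul, one_mul, Nat.add_sub_cancel]
        abel
  rw [hz, key, add_eq_left, h.mul_eq_zero_iff, map_mul, h.map_mul_eq_zero, mul_zero]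

/-- If `w² ≡ 0` modulo `p`, then `(1 + w)^p = 1 + p w + w^p`. -/
theorem one_add_pow (h : IsModPReduction p φ) (hp : p.Prime) {w : R} (hw : φ w ^ 2 = 0) :
    (1 + w) ^ p = 1 + p * w + w ^ p := by
  have hw2 : (p : R) * w ^ 2 = 0 := (h.mul_eq_zero_iff _).2 (by rw [map_pow, hw])
  rw [add_comm, (Commute.one_right w).add_pow, Finset.sum_range_succ]
  obtain ⟨q, rfl⟩ : ∃ q, p = q + 2 := ⟨p - 2, by have := hp.two_le; omega⟩
  rw [Finset.sum_range_succ', Finset.sum_range_succ', Finset.sum_eq_zero]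
  · have := (Nat.cast_commute (q + 2) w).eq
    push_cast at this
    simp [add_comm, this]
  · intro i hi
    rw [Finset.mem_range] at hi
    obtain ⟨c, hc⟩ := hp.dvd_choose_self (k := i + 1 + 1) (by omega) (by omega)
    rw [hc, one_pow, mul_one, add_assoc, pow_add, mul_assoc, Nat.cast_mul, ← mul_assoc (w ^ (1 + 1)),
      ← (Nat.cast_commute _ (w ^ (1 + 1))).eq, hw2, zero_mul, mul_zero]

end Ring

theorem matrixMap {p : ℕ} {R S : Type*} [CommRing R] [CommRing S] {φ : R →+* S}
    (h : IsModPReduction p φ) (ι : Type*) [Fintype ι] [DecidableEq ι] :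
    IsModPReduction p (φ.mapMatrix : Matrix ι ι R →+* Matrix ι ι S) where
  surjective M := ⟨fun i j => (h.surjective (M i j)).choose,
    by ext i j; exact (h.surjective (M i j)).choose_spec⟩
  eq_zero_iff_exists M := by
    constructor
    · intro hM
      choose N hN using fun i j => (h.eq_zero_iff_exists (M i j)).1 (congrFun₂ hM i j)
      refine ⟨Matrix.of N, ?_⟩
      ext i j
      rw [← nsmul_eq_mul, Matrix.smul_apply, nsmul_eq_mul, hN]
      rfl
    · rintro ⟨N, rfl⟩
      ext i j
      rw [← nsmul_eq_mul, RingHom.mapMatrix_apply, Matrix.map_apply, Matrix.smul_apply, nsmul_eq_mul,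
        h.map_mul_eq_zero, Matrix.zero_apply]
  mul_eq_zero_iff M := by
    simp only [← nsmul_eq_mul, ← Matrix.ext_iff, Matrix.smul_apply, Matrix.zero_apply,
      RingHom.mapMatrix_apply, Matrix.map_apply]
    simp only [nsmul_eq_mul, h.mul_eq_zero_iff]

open Polynomial in
theorem polynomialMap {p : ℕ} {R S : Type*} [CommRing R] [CommRing S] {φ : R →+* S}
    (h : IsModPReduction p φ) : IsModPReduction p (mapRingHom φ) where
  surjective := Polynomial.map_surjective φ h.surjective
  eq_zero_iff_exists f := by
    rw [← C_eq_natCast]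
    change _ ↔ C (p : R) ∣ f
    rw [C_dvd_iff_dvd_coeff, Polynomial.ext_iff]
    simp [h.eq_zero_iff_exists, Dvd.dvd]
  mul_eq_zero_iff f := by
    rw [← C_eq_natCast, Polynomial.ext_iff, Polynomial.ext_iff]
    simp only [coeff_C_mul, coeff_zero, coe_mapRingHom, coeff_map, h.mul_eq_zero_iff]

end IsModPReduction

theorem wittReduce_truncate (p : ℕ) [Fact p.Prime] (k : Type*) [CommRing k] (x : WittVector p k) :
    wittReduce p k (WittVector.truncate 2 x) = x.coeff 0 :=
  RingHom.liftOfRightInverse_comp_apply _ _ _ ⟨WittVector.constantCoeff, _⟩ x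

theorem isModPReduction_wittReduce (p : ℕ) [Fact p.Prime] (k : Type*) [Field k] [Fintype k]
    [CharP k p] : IsModPReduction p (wittReduce p k) where
  surjective c := ⟨WittVector.truncate 2 (WittVector.teichmuller p c), by
    rw [wittReduce_truncate, WittVector.teichmuller_coeff_zero]⟩
  eq_zero_iff_exists x := by
    obtain ⟨x, rfl⟩ := WittVector.truncate_surjective p 2 k x
    constructor
    · intro hx
      rw [wittReduce_truncate] at hx
      obtain ⟨y, hy⟩ := (WittVector.frobenius_bijective p k).2 (x.shift 1)
      refine ⟨WittVector.truncate 2 y, ?_⟩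
      have := WittVector.eq_iterate_verschiebung (x := x) (n := 1) (by simpa using hx)
      rw [Function.iterate_one, ← hy, WittVector.verschiebung_frobenius] at this
      rw [this, map_mul, map_natCast, mul_comm]
    · rintro ⟨y, hy⟩
      rw [hy, map_mul, map_natCast, CharP.cast_eq_zero, zero_mul]
  mul_eq_zero_iff x := by
    obtain ⟨x, rfl⟩ := WittVector.truncate_surjective p 2 k x
    rw [wittReduce_truncate, mul_comm, ← map_natCast (WittVector.truncate 2), ← map_mul,
      ← WittVector.verschiebung_frobenius, ← RingHom.mem_ker, WittVector.mem_ker_truncate]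
    constructor
    · intro h
      have := h 1 (by norm_num)
      rw [WittVector.verschiebung_coeff_succ, WittVector.coeff_frobenius_charP] at this
      exact pow_eq_zero_iff (Fact.out : p.Prime).ne_zero |>.1 this
    · intro h i hi
      interval_cases i
      · exact WittVector.verschiebung_coeff_zero _
      · rw [WittVector.verschiebung_coeff_succ, WittVector.coeff_frobenius_charP, h,
          zero_pow (Fact.out : p.Prime).ne_zero]

namespace IsModPReduction

variable {p : ℕ} {R S : Type*} [Ring R] [Ring S] {φ : R →+* S}

theorem mul_eq_zero_of_map_eq_zero (h : IsModPReduction p φ) {x y : R} (hx : φ x = 0)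
    (hy : φ y = 0) : x * y = 0 := by
  obtain ⟨z, rfl⟩ := (h.eq_zero_iff_exists x).1 hx
  rw [mul_assoc, h.mul_eq_zero_iff, map_mul, hy, mul_zero]

/-- A unipotent element `1 + J` with `J ^ (p ^ e + 1) = 0` can only lift to an element of order
dividing `p ^ (e + 1)` if `J ^ (p ^ e) = 0`, provided `2 (p ^ e + 1) ≤ p ^ (e + 1)`. -/
theorem pow_eq_zero_of_lift (h : IsModPReduction p φ) (hp : p.Prime) [CharP S p] {e : ℕ}
    (he : 2 * (p ^ e + 1) ≤ p ^ (e + 1)) {s : R} (hs : s ^ p ^ (e + 1) = 1) {J : S}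
    (hJ : φ s = 1 + J) (hJ0 : J ^ (p ^ e + 1) = 0) : J ^ p ^ e = 0 := by
  have : Fact p.Prime := ⟨hp⟩
  have hw : φ (s - 1) = J := by rw [map_sub, map_one, hJ, add_sub_cancel_left]
  have hw' : φ (s ^ p ^ e - 1) = J ^ p ^ e := by
    rw [map_sub, map_one, map_pow, hJ, add_pow_char_pow_of_commute _ _ (Commute.one_left J),
      one_pow, add_sub_cancel_left]
  have h1 : (p : R) * (s ^ p ^ e - 1) + (s ^ p ^ e - 1) ^ p = 0 := by
    have := h.one_add_pow hp (w := s ^ p ^ e - 1) (by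
      rw [hw', ← pow_mul]
      exact pow_eq_zero_of_le (by have := hp.pos; have := Nat.one_le_pow e p this; omega) hJ0)
    rw [add_sub_cancel, ← pow_mul, ← pow_succ, hs, add_assoc] at this
    exact (left_eq_add.1 this)
  have h2 : (s ^ p ^ e - 1) ^ p = 0 := by
    rw [h.pow_eq_pow (y := (s - 1) ^ p ^ e) _ (by rw [hw', map_pow, hw]), ← pow_mul, ← pow_succ]
    · refine pow_eq_zero_of_le he ?_
      rw [two_mul, pow_add]
      have : φ ((s - 1) ^ (p ^ e + 1)) = 0 := by rw [map_pow, hw, hJ0]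
      exact h.mul_eq_zero_of_map_eq_zero this this
    · refine Commute.pow_right ?_ _
      exact ((Commute.refl s).pow_left _ |>.sub_left (Commute.one_left s)).sub_right
        (Commute.one_right _)
  rw [h2, add_zero, h.mul_eq_zero_iff, hw'] at h1
  exact h1

/-- If commuting elements `s`, `t` of order dividing `p` satisfy `s - 1 ≡ l (t - 1)` modulo `p`
for a central `l`, and `(t - 1)² ≡ 0` modulo `p`, then `(l - l ^ p) (t - 1) ≡ 0` modulo `p`. -/
theorem sub_pow_mul_eq_zero_of_lift (h : IsModPReduction p φ) (hp : p.Prime) {s t l : R}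
    (hst : Commute s t) (hl : ∀ x, Commute l x) (hs : s ^ p = 1) (ht : t ^ p = 1)
    (hrel : φ (s - 1) = φ l * φ (t - 1)) (hsq : φ (t - 1) ^ 2 = 0) :
    (φ l - φ l ^ p) * φ (t - 1) = 0 := by
  have h1 : (p : R) * (t - 1) + (t - 1) ^ p = 0 := by
    have := h.one_add_pow hp hsq
    rw [add_sub_cancel, ht, add_assoc] at this
    exact left_eq_add.1 this
  have h2 : (p : R) * (s - 1) + (s - 1) ^ p = 0 := by
    have := h.one_add_pow hp (w := s - 1) (by
      rw [hrel, ((hl (t - 1)).map φ).mul_pow, hsq, mul_zero])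
    rw [add_sub_cancel, hs, add_assoc] at this
    exact left_eq_add.1 this
  have h3 : (s - 1) ^ p = l ^ p * (t - 1) ^ p := by
    rw [← (hl (t - 1)).mul_pow]
    refine h.pow_eq_pow (Commute.mul_right (hl _).symm ?_) (by rw [hrel, map_mul])
    exact (hst.sub_left (Commute.one_left t)).sub_right (Commute.one_right _)
  have h4 : (p : R) * ((s - 1) - l ^ p * (t - 1)) = 0 := by
    rw [mul_sub, ← mul_assoc, (Nat.cast_commute p (l ^ p)).eq, mul_assoc, eq_neg_of_add_eq_zero_left h1,
      eq_neg_of_add_eq_zero_left h2, h3, mul_neg, sub_self]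
  rw [h.mul_eq_zero_iff, map_sub, map_mul, map_pow, hrel, ← sub_mul] at h4
  exact h4

end IsModPReduction

/-- A homomorphism from a group with property `L_p` to the units of a finite commutative
`k`-algebra, regarded as a matrix representation, lifts modulo `p²`. -/
theorem HasLp.exists_lift {p : ℕ} [Fact p.Prime] {G : Type*} [Group G] (hG : HasLp p G)
    (k : Type) [Field k] [Fintype k] [CharP k p] {A : Type} [CommRing A] [Nontrivial A]
    [Algebra k A] [Module.Finite k A] (f : G →* Aˣ) :
    ∃ (D E : Type) (_ : Ring D) (_ : Ring E) (φ : E →+* D) (Λ : A →+* D) (g : G →* E),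
      IsModPReduction p φ ∧ CharP D p ∧ Function.Injective Λ ∧ (∀ x, φ (g x) = Λ (f x)) ∧
      ∀ c : k, ∃ l : E, (∀ x, Commute l x) ∧ φ l = Λ (algebraMap k A c) := by
  let b := Module.finBasis k A
  have hn : 1 ≤ Module.finrank k A := Module.finrank_pos
  have : Nonempty (Fin (Module.finrank k A)) := ⟨⟨0, hn⟩⟩
  obtain ⟨g, hg⟩ := hG _ hn k
    ((Units.map (Algebra.leftMulMatrix b : A →* Matrix _ _ k)).comp f)
  have hred := isModPReduction_wittReduce p k
  refine ⟨_, _, inferInstance, inferInstance, (wittReduce p k).mapMatrix,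
    (Algebra.leftMulMatrix b : A →+* Matrix _ _ k), (Units.coeHom _).comp g, hred.matrixMap _,
    inferInstance, Algebra.leftMulMatrix_injective b, fun x => ?_, fun c => ?_⟩
  · exact congrArg Units.val (DFunLike.congr_fun hg x)
  · obtain ⟨l, hl⟩ := hred.surjective c
    refine ⟨algebraMap _ _ l, fun x => Algebra.commutes l x, ?_⟩
    rw [RingHom.coe_coe, AlgHom.commutes, ← hl]
    ext i j
    rw [RingHom.mapMatrix_apply, Matrix.map_apply, Matrix.algebraMap_matrix_apply,
      Matrix.algebraMap_matrix_apply, apply_ite (wittReduce p k), map_zero]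
    rfl

/-- The elements `t i` behave like generators of independent cyclic factors of `G` of orders `n i`,
as far as homomorphisms to commutative groups are concerned. -/
def HasCoordinates {G : Type*} [Group G] {ι : Type*} (n : ι → ℕ) (t : ι → G) : Prop :=
  ∀ (H : Type) [CommGroup H] (i : ι) (u : H), u ^ n i = 1 →
    ∃ θ : G →* H, θ (t i) = u ∧ ∀ j, j ≠ i → θ (t j) = 1

theorem exists_hasCoordinates {G : Type*} [CommGroup G] {ι : Type*} [DecidableEq ι] (n : ι → ℕ)
    (φ : Additive G ≃+ DirectSum ι fun i => ZMod (n i)) :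
    ∃ t : ι → G, (∀ i, t i ^ n i = 1) ∧ HasCoordinates n t := by
  refine ⟨fun i => (φ.symm (DirectSum.of _ i 1)).toMul, fun i => ?_, fun H _ i u hu => ?_⟩
  · rw [← toMul_nsmul, ← map_nsmul, ← map_nsmul]
    simp
  · let θ : ZMod (n i) →+ Additive H := ZMod.lift (n i) ⟨zmultiplesHom _ (Additive.ofMul u), by
      rw [zmultiplesHom_apply, natCast_zsmul, ← ofMul_pow, hu, ofMul_one]⟩
    have hθ : θ 1 = Additive.ofMul u := by
      have := ZMod.lift_coe (n i) ⟨zmultiplesHom _ (Additive.ofMul u), by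
        rw [zmultiplesHom_apply, natCast_zsmul, ← ofMul_pow, hu, ofMul_one]⟩ 1
      simpa using this
    refine ⟨MonoidHom.toAdditive.symm
      ((θ.comp (DirectSum.component ℤ ι _ i).toAddMonoidHom).comp φ.toAddMonoidHom), ?_, ?_⟩
    · change (θ (DirectSum.component ℤ ι _ i (φ (φ.symm (DirectSum.of _ i 1))))).toMul = u
      rw [AddEquiv.apply_symm_apply, DirectSum.component, DFinsupp.lapply_apply,
        DirectSum.of_eq_same, hθ, toMul_ofMul]
    · intro j hj
      change (θ (DirectSum.component ℤ ι _ i (φ (φ.symm (DirectSum.of _ j 1))))).toMul = 1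
      rw [AddEquiv.apply_symm_apply, DirectSum.component, DFinsupp.lapply_apply,
        DirectSum.of_eq_of_ne _ _ _ hj.symm, map_zero, toMul_zero]

open Polynomial in
theorem exists_algebra_nilpotent (k : Type) [Field k] {r : ℕ} (hr : 0 < r) :
    ∃ (A : Type) (_ : CommRing A) (_ : Nontrivial A) (_ : Algebra k A) (_ : Module.Finite k A)
      (ε : A), ∀ m, ε ^ m = 0 ↔ r ≤ m := by
  have : Fact ((X ^ r : k[X]).degree ≠ 0) := ⟨by simp [hr.ne']⟩
  refine ⟨AdjoinRoot (X ^ r : k[X]), inferInstance, AdjoinRoot.nontrivial _ Fact.out, inferInstance,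
    (monic_X_pow r).finite_adjoinRoot, AdjoinRoot.root _, fun m => ?_⟩
  rw [← AdjoinRoot.mk_X, ← map_pow, AdjoinRoot.mk_eq_zero, pow_dvd_pow_iff X_ne_zero not_isUnit_X]

theorem HasLp.lt_of_hasCoordinates {p : ℕ} [hp : Fact p.Prime] {G : Type*} [Group G] {ι : Type*}
    {n : ι → ℕ} {t : ι → G} (hG : HasLp p G) (ht : ∀ i, t i ^ n i = 1) (hc : HasCoordinates n t)
    {i : ι} {e : ℕ} (hi : n i = p ^ (e + 1)) : p ^ (e + 1) < 2 * (p ^ e + 1) := by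
  by_contra! he
  obtain ⟨A, _, _, _, _, ε, hε⟩ := exists_algebra_nilpotent (ZMod p) (Nat.succ_pos (p ^ e))
  have : CharP A p := charP_of_injective_algebraMap (algebraMap (ZMod p) A).injective p
  have hu : (1 + ε) ^ p ^ (e + 1) = 1 := by
    rw [add_pow_char_pow, one_pow, (hε _).2 (by omega), add_zero]
  obtain ⟨θ, hθ, -⟩ := hc Aˣ i (Units.ofPowEqOne _ _ hu (pow_ne_zero _ hp.out.ne_zero))
    (by rw [hi]; exact Units.ext hu)
  obtain ⟨D, E, _, _, φ, Λ, g, hφ, _, hΛ, hg, -⟩ := hG.exists_lift (ZMod p) θ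
  have h0 := hφ.pow_eq_zero_of_lift hp.out he (s := g (t i)) (J := Λ ε)
    (by rw [← map_pow, ← hi, ht, map_one])
    (by rw [hg, hθ, ← map_one Λ, ← map_add]; rfl)
    (by rw [← map_pow, (hε _).2 le_rfl, map_zero])
  rw [← map_pow, map_eq_zero_iff Λ hΛ, hε] at h0
  omega

open Polynomial in
theorem exists_pow_ne_self_galoisField (p : ℕ) [Fact p.Prime] :
    ∃ c : GaloisField p 2, c ^ p ≠ c := by
  have hp : 1 < p := (Fact.out : p.Prime).one_lt
  by_contra! hall
  have := Fintype.ofFinite (GaloisField p 2)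
  have hle := card_le_degree_of_subset_roots (p := (X ^ p - X : (GaloisField p 2)[X]))
    (Z := Finset.univ) (fun c _ => by
      rw [mem_roots (FiniteField.X_pow_card_sub_X_ne_zero _ hp)]
      simp [hall c])
  rw [FiniteField.X_pow_card_sub_X_natDegree_eq _ hp, Finset.card_univ,
    ← Nat.card_eq_fintype_card, GaloisField.card p 2 two_ne_zero] at hle
  nlinarith

theorem HasLp.eq_of_hasCoordinates {p : ℕ} [hp : Fact p.Prime] {G : Type*} [CommGroup G]
    {ι : Type*} {n : ι → ℕ} {t : ι → G} (hG : HasLp p G) (ht : ∀ i, t i ^ n i = 1)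
    (hc : HasCoordinates n t) {i j : ι} {a b : ℕ} (hi : n i = p ^ (a + 1))
    (hj : n j = p ^ (b + 1)) : i = j := by
  by_contra hij
  let k := GaloisField p 2
  have : Fintype k := Fintype.ofFinite k
  obtain ⟨c, hcp⟩ := exists_pow_ne_self_galoisField p
  obtain ⟨m, hm⟩ := (iterateFrobeniusEquiv k p a).surjective c
  rw [iterateFrobeniusEquiv_def] at hm
  have hpos : 0 < p ^ (a + b) := pow_pos hp.out.pos _
  have hle : 2 * p ^ (a + b) ≤ p ^ (a + b + 1) := by
    rw [pow_succ, mul_comm]; exact Nat.mul_le_mul_left _ hp.out.two_le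
  obtain ⟨A, _, _, _, _, ε, hε⟩ := exists_algebra_nilpotent k (Nat.mul_pos two_pos hpos)
  have : CharP A p := charP_of_injective_algebraMap (algebraMap k A).injective p
  have hx : (1 + algebraMap k A m * ε ^ p ^ b) ^ p ^ (a + 1) = 1 := by
    rw [add_pow_char_pow, one_pow, mul_pow, ← pow_mul, ← pow_add,
      (hε _).2 (by rwa [← add_assoc, add_comm b]), mul_zero, add_zero]
  have hy : (1 + ε ^ p ^ a) ^ p ^ (b + 1) = 1 := by
    rw [add_pow_char_pow, one_pow, ← pow_mul, ← pow_add,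
      (hε _).2 (by rwa [← add_assoc]), add_zero]
  obtain ⟨θ, hθi, hθj⟩ := hc Aˣ i (Units.ofPowEqOne _ _ hx (pow_ne_zero _ hp.out.ne_zero))
    (by rw [hi]; exact Units.ext hx)
  obtain ⟨η, hηj, hηi⟩ := hc Aˣ j (Units.ofPowEqOne _ _ hy (pow_ne_zero _ hp.out.ne_zero))
    (by rw [hj]; exact Units.ext hy)
  obtain ⟨D, E, _, _, φ, Λ, g, hφ, _, hΛ, hg, hcen⟩ := hG.exists_lift k (θ * η)
  obtain ⟨l, hl, hlc⟩ := hcen c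
  have hs : φ (g (t i) ^ p ^ a - 1) = Λ (algebraMap k A c * ε ^ p ^ (a + b)) := by
    rw [map_sub, map_pow, hg, MonoidHom.mul_apply, hθi, hηi i hij, mul_one, map_one, ← map_pow,
      Units.val_ofPowEqOne, add_pow_char_pow, one_pow, mul_pow, ← map_pow, hm, ← pow_mul, ← pow_add,
      map_add, map_one, add_sub_cancel_left, add_comm b]
  have ht' : φ (g (t j) ^ p ^ b - 1) = Λ (ε ^ p ^ (a + b)) := by
    rw [map_sub, map_pow, hg, MonoidHom.mul_apply, hθj j (Ne.symm hij), hηj, one_mul, map_one,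
      ← map_pow, Units.val_ofPowEqOne, add_pow_char_pow, one_pow, ← pow_mul, ← pow_add,
      map_add, map_one, add_sub_cancel_left]
  have key := hφ.sub_pow_mul_eq_zero_of_lift hp.out (s := g (t i) ^ p ^ a) (t := g (t j) ^ p ^ b)
    (l := l) (((Commute.all (t i) (t j)).map g).pow_pow _ _) hl
    (by rw [← pow_mul, ← pow_succ, ← hi, ← map_pow, ht, map_one])
    (by rw [← pow_mul, ← pow_succ, ← hj, ← map_pow, ht, map_one])
    (by rw [hs, hlc, ht', map_mul])
    (by rw [ht', ← map_pow, ← pow_mul, (hε _).2 (by rw [mul_comm]), map_zero])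
  rw [hlc, ht', ← map_pow, ← map_sub, ← map_mul, map_eq_zero_iff Λ hΛ, ← map_pow, ← map_sub] at key
  have hunit : IsUnit (algebraMap k A (c - c ^ p)) :=
    (isUnit_iff_ne_zero.2 (sub_ne_zero.2 (Ne.symm hcp))).map _
  rw [hunit.mul_right_eq_zero, hε] at key
  omega

theorem exists_prod_eq_two_pow_or {ι : Type*} (s : Finset ι) (a : ι → ℕ)
    (ha : ∀ i ∈ s, (∃ k, a i = 2 ^ k) ∨ a i = 3)
    (hco : (s : Set ι).Pairwise fun i j => Nat.Coprime (a i) (a j)) :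
    ∃ n, ∏ i ∈ s, a i = 2 ^ n ∨ ∏ i ∈ s, a i = 3 * 2 ^ n := by
  classical
  induction s using Finset.induction_on with
  | empty => exact ⟨0, by simp⟩
  | insert i s hi ih =>
    obtain ⟨n, hn⟩ := ih (fun j hj => ha j (Finset.mem_insert_of_mem hj))
      (hco.mono (by simp))
    have hcop : Nat.Coprime (a i) (∏ j ∈ s, a j) :=
      Nat.Coprime.prod_right fun j hj => hco (by simp) (by simp [hj]) (by rintro rfl; exact hi hj)
    rw [Finset.prod_insert hi]
    rcases ha i (Finset.mem_insert_self i s) with ⟨k, hk⟩ | hk <;> rcases hn with hn | hn <;>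
      rw [hk, hn]
    · exact ⟨k + n, Or.inl (pow_add 2 k n).symm⟩
    · exact ⟨k + n, Or.inr (by ring)⟩
    · exact ⟨n, Or.inr rfl⟩
    · rw [hk, hn] at hcop
      exact absurd (hcop.eq_one_of_dvd ⟨_, rfl⟩) (by norm_num)

theorem HasL.isCyclic_and_card {G : Type*} [CommGroup G] [Finite G] (hG : HasL G) :
    IsCyclic G ∧ ∃ n : ℕ, Nat.card G = 2 ^ n ∨ Nat.card G = 3 * 2 ^ n := by
  classical
  obtain ⟨ι, _, p, hp, e, ⟨φ⟩⟩ := AddCommGroup.equiv_directSum_zmod_of_finite (Additive G)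
  obtain ⟨t, ht, hc⟩ := exists_hasCoordinates (fun i => p i ^ e i) φ
  have hshape : ∀ i, (∃ k, p i ^ e i = 2 ^ k) ∨ p i ^ e i = 3 := by
    intro i
    rcases hei : e i with _ | m
    · exact Or.inl ⟨0, by simp⟩
    · have := Fact.mk (hp i)
      have hlt := (hG (p i)).lt_of_hasCoordinates ht hc (i := i) (e := m) (by simp only [hei])
      have h1 : 0 < p i ^ m := pow_pos (hp i).pos m
      rw [pow_succ] at hlt
      have h3 : p i ≤ 3 := by
        by_contra! h
        nlinarith
      have h2 := (hp i).two_le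
      rcases (show p i = 2 ∨ p i = 3 by omega) with h | h
      · exact Or.inl ⟨m + 1, by rw [h]⟩
      · right
        rw [h] at hlt h1 ⊢
        rcases m with _ | m
        · rfl
        · rw [pow_succ] at hlt
          have : 0 < 3 ^ m := by positivity
          omega
  have hco : Pairwise fun i j => Nat.Coprime (p i ^ e i) (p j ^ e j) := by
    intro i j hij
    rcases hei : e i with _ | a
    · simp
    rcases hej : e j with _ | b
    · simp
    have := Fact.mk (hp i)
    refine Nat.Coprime.pow _ _ ((Nat.coprime_primes (hp i) (hp j)).2 fun hpij => hij ?_)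
    exact (hG (p i)).eq_of_hasCoordinates ht hc (a := a) (b := b) (by simp only [hei])
      (by simp only [hej, hpij])
  have ψ : Additive G ≃+ ZMod (∏ i, p i ^ e i) :=
    (φ.trans (DirectSum.addEquivProd _)).trans (ZMod.prodEquivPi _ hco).symm.toAddEquiv
  constructor
  · rw [← isAddCyclic_additive_iff]
    exact isAddCyclic_of_surjective ψ.symm ψ.symm.surjective
  · rw [show Nat.card G = ∏ i, p i ^ e i from (Nat.card_congr ψ.toEquiv).trans (Nat.card_zmod _)]
    exact exists_prod_eq_two_pow_or Finset.univ _ (fun i _ => hshape i)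
      (fun i _ j _ hij => hco hij)

section PolynomialLift

open Polynomial

variable {p : ℕ} {W k : Type*} [CommRing W] [Field k] {φ : W →+* k}

/-- If `F = Q R + p g` where `g` lies in the ideal generated by `Q` and `R` modulo `p`, then `Q` can
be modified by a multiple of `p` to become a monic divisor of `F`. -/
theorem IsModPReduction.exists_monic_dvd (h : IsModPReduction p φ) {F Q R g : W[X]} (hQ : Q.Monic)
    (hF : F = Q * R + (p : W[X]) * g) {a b : k[X]}
    (hg : g.map φ = a * R.map φ + b * Q.map φ) :
    ∃ Q' : W[X], Q'.Monic ∧ Q'.map φ = Q.map φ ∧ Q' ∣ F := by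
  have hP := h.polynomialMap
  have : Nontrivial W := RingHom.domain_nontrivial φ
  have hQm : (Q.map φ).Monic := hQ.map φ
  obtain ⟨A, hA, hdeg⟩ := exists_degree_eq_of_mem_lifts (f := φ) (p := a %ₘ Q.map φ)
    (mem_lifts_of_surjective h.surjective _)
  obtain ⟨B, hB⟩ := hP.surjective (b + (a /ₘ Q.map φ) * R.map φ)
  rw [coe_mapRingHom] at hB
  have hpA : (p : W[X]) * A = (p : W) • A := by rw [smul_eq_C_mul, C_eq_natCast]
  refine ⟨Q + p * A, hQ.add_of_left ?_, ?_, R + p * B, ?_⟩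
  · rw [hpA]
    refine lt_of_le_of_lt (degree_smul_le _ _) ?_
    rw [hdeg, ← hQ.degree_map φ]
    exact degree_modByMonic_lt _ hQm
  · have := hP.map_mul_eq_zero A
    rw [coe_mapRingHom] at this
    rw [Polynomial.map_add, this, add_zero]
  · have h1 : (p : W[X]) * g = p * (A * R + Q * B) := by
      refine hP.mul_eq_mul _ _ ?_
      simp only [coe_mapRingHom, Polynomial.map_add, Polynomial.map_mul, hA, hB, hg]
      conv_lhs => rw [← modByMonic_add_div a (Q.map φ)]
      ring
    have h2 := hP.mul_mul_eq_zero (A * B)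
    rw [hF, h1]
    linear_combination -h2

/-- A power of a monic irreducible polynomial dividing `X ^ N - 1` lifts to a monic divisor of
`X ^ N - 1`, provided the `p`-part `p ^ m` of `N` is small enough. -/
theorem IsModPReduction.exists_monic_dvd_X_pow_sub_one (h : IsModPReduction p φ) (hp : p.Prime)
    [CharP k p] {m N : ℕ} (hN : ¬ p ∣ N)
    (hm : m = 0 ∨ ∀ r ≤ p ^ m, r ≤ p ^ (m - 1) ∨ p ^ m - r ≤ p ^ (m - 1))
    {q : k[X]} (hq : q.Monic) (hqi : Irreducible q) {r : ℕ}
    (hdvd : q ^ r ∣ X ^ (p ^ m * N) - 1) :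
    ∃ Q : W[X], Q.Monic ∧ Q.map φ = q ^ r ∧ Q ∣ X ^ (p ^ m * N) - 1 := by
  have hpf : Fact p.Prime := ⟨hp⟩
  rcases Nat.eq_zero_or_pos r with rfl | hr
  · exact ⟨1, monic_one, by simp, one_dvd _⟩
  have hP := h.polynomialMap
  have hfrob : ∀ j : ℕ, (X ^ (p ^ j * N) - 1 : k[X]) = (X ^ N - 1) ^ p ^ j := by
    intro j
    rw [sub_pow_char_pow, one_pow, ← pow_mul, mul_comm]
  have hsep : (X ^ N - 1 : k[X]).Separable :=
    X_pow_sub_one_separable_iff.2 (by rwa [Ne, CharP.cast_eq_zero_iff k p])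
  have hqz : q ∣ X ^ N - 1 := by
    refine hqi.prime.dvd_of_dvd_pow (n := p ^ m) ?_
    rw [← hfrob]
    exact (dvd_pow_self q hr.ne').trans hdvd
  obtain ⟨t, ht⟩ := hqz
  have hcop : IsCoprime q t := Polynomial.Separable.isCoprime (ht ▸ hsep)
  have hrle : r ≤ p ^ m := by
    rw [hfrob, ht, mul_pow] at hdvd
    have := (hcop.pow (m := r) (n := p ^ m)).dvd_of_dvd_mul_right hdvd
    exact (pow_dvd_pow_iff hqi.ne_zero hqi.not_isUnit).1 this
  obtain ⟨Q, hQ, -, hQm⟩ := lifts_and_natDegree_eq_and_monic (f := φ) (p := q)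
    (mem_lifts_of_surjective h.surjective _) hq
  obtain ⟨T, hT⟩ := hP.surjective t
  rw [coe_mapRingHom] at hT
  -- the error term of the naive lift of the factorisation
  obtain ⟨g, hg, d, hgd, hd⟩ : ∃ g : W[X],
      (X ^ (p ^ m * N) - 1 : W[X]) = Q ^ r * (Q ^ (p ^ m - r) * T ^ p ^ m) + (p : W[X]) * g ∧
      ∃ d, q ^ d ∣ g.map φ ∧ (r ≤ d ∨ p ^ m - r ≤ d) := by
    rw [← mul_assoc, ← pow_add, Nat.add_sub_cancel' hrle, ← mul_pow]
    rcases Nat.eq_zero_or_pos m with rfl | hmpos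
    · obtain ⟨g, hg⟩ := hP.exists_eq_add (X ^ (p ^ 0 * N) - 1 : W[X]) ((Q * T) ^ p ^ 0)
        (by simp [hQ, hT, ht])
      exact ⟨g, hg, 0, by simp, Or.inr (by rw [pow_zero] at *; omega)⟩
    · obtain ⟨m, rfl⟩ := Nat.exists_eq_succ_of_ne_zero hmpos.ne'
      rw [Nat.succ_eq_add_one] at *
      set w : W[X] := X ^ (p ^ m * N) - 1 with hw
      have hwφ : w.map φ = (q * t) ^ p ^ m := by
        rw [hw, ← ht, ← hfrob]; simp
      have hwp : w ^ p = (Q * T) ^ p ^ (m + 1) := by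
        rw [pow_succ, pow_mul]
        refine hP.pow_eq_pow (Commute.all _ _) ?_
        rw [coe_mapRingHom, hwφ]
        simp [hQ, hT]
      obtain ⟨v, hv⟩ := exists_add_pow_prime_eq hp 1 w
      refine ⟨w * v, ?_, p ^ m, ?_, ?_⟩
      · have : (X ^ (p ^ (m + 1) * N) : W[X]) = (1 + w) ^ p := by
          rw [hw, add_sub_cancel, ← pow_mul, pow_succ]
          congr 1; ring
        rw [this, hv, hwp]
        ring
      · rw [Polynomial.map_mul, hwφ, mul_pow, mul_assoc]
        exact dvd_mul_right _ _
      · simpa using hm.resolve_left m.succ_ne_zero r hrle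
  obtain ⟨a, b, hab⟩ : ∃ a b : k[X], g.map φ =
      a * (Q ^ (p ^ m - r) * T ^ p ^ m).map φ + b * (Q ^ r).map φ := by
    simp only [Polynomial.map_mul, Polynomial.map_pow, hQ, hT]
    rcases le_total r (p ^ m - r) with hle | hle
    · obtain ⟨c, hc⟩ := (pow_dvd_pow q (show r ≤ d by omega)).trans hgd
      exact ⟨0, c, by rw [hc]; ring⟩
    · obtain ⟨c, hc⟩ := (pow_dvd_pow q (show p ^ m - r ≤ d by omega)).trans hgd
      obtain ⟨x, y, hxy⟩ := hcop.pow (m := r - (p ^ m - r)) (n := p ^ m)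
      refine ⟨c * y, c * x, ?_⟩
      have : q ^ r = q ^ (p ^ m - r) * q ^ (r - (p ^ m - r)) := by
        rw [← pow_add, Nat.add_sub_cancel' hle]
      rw [hc, this]
      linear_combination (-q ^ (p ^ m - r) * c) * hxy
  obtain ⟨Q', h1, h2, h3⟩ := h.exists_monic_dvd (hQm.pow r) hg hab
  exact ⟨Q', h1, by rw [h2, Polynomial.map_pow, hQ], h3⟩

end PolynomialLift

open Polynomial in
/-- A square matrix over a field is multiplication by `X` on a product of rings `k[X] / (q ^ e)`
with `q` irreducible. -/
theorem Matrix.exists_linearEquiv_adjoinRoot {k : Type} [Field k] {n : ℕ}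
    (A : Matrix (Fin n) (Fin n) k) :
    ∃ (ι : Type) (_ : Fintype ι) (f : ι → k[X]),
      (∀ i, ∃ (q : k[X]) (r : ℕ), q.Monic ∧ Irreducible q ∧ f i = q ^ r) ∧
      ∃ E : (Fin n → k) ≃ₗ[k] Π i, AdjoinRoot (f i),
        ∀ v, E (A.mulVec v) = (fun i => AdjoinRoot.root (f i)) * E v := by
  classical
  obtain ⟨ι, hι, q, hq, e, ⟨g⟩⟩ := Module.equiv_directSum_of_isTorsion
    (Module.AEval.isTorsion_of_finiteDimensional k (Fin n → k) (Matrix.toLin' A))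
  have hspan : ∀ i, Ideal.span {q i ^ e i} = Ideal.span {normalize (q i) ^ e i} := fun i => by
    rw [Ideal.span_singleton_eq_span_singleton]
    exact (associated_normalize _).pow_pow
  let g' : Module.AEval' (Matrix.toLin' A) ≃ₗ[k[X]]
      Π i, k[X] ⧸ Ideal.span {normalize (q i) ^ e i} :=
    g.trans ((DirectSum.linearEquivFunOnFintype k[X] ι _).trans
      (LinearEquiv.piCongrRight fun i => Submodule.quotEquivOfEq _ _ (hspan i)))
  refine ⟨ι, hι, fun i => normalize (q i) ^ e i,
    fun i => ⟨normalize (q i), e i, monic_normalize (hq i).ne_zero,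
      (associated_normalize _).irreducible (hq i), rfl⟩,
    { (Module.AEval'.of (Matrix.toLin' A)).toAddEquiv.trans g'.toAddEquiv with
      map_smul' := fun c v => ?_ }, fun v => ?_⟩
  · change g' (Module.AEval'.of _ (c • v)) = c • g' (Module.AEval'.of _ v)
    rw [map_smul, ← Module.AEval.C_smul, map_smul]
    ext i
    rw [Pi.smul_apply, Pi.smul_apply, ← algebraMap_eq, algebraMap_smul]
  · change g' (Module.AEval'.of _ (Matrix.toLin' A v)) = _ * g' (Module.AEval'.of _ v)
    rw [← Module.AEval'.X_smul_of, map_smul]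
    ext i
    exact Algebra.smul_def (A := k[X] ⧸ Ideal.span {normalize (q i) ^ e i}) (X : k[X]) _

namespace IsModPReduction

variable {p : ℕ} {W k : Type*} [CommRing W] [Field k] {φ : W →+* k}

theorem exists_mul_eq_one (h : IsModPReduction p φ) {ι : Type*} [Fintype ι] [DecidableEq ι]
    {P P' : Matrix ι ι k} (hP : P * P' = 1) :
    ∃ T T' : Matrix ι ι W, T * T' = 1 ∧ T' * T = 1 ∧ T.map φ = P ∧ T'.map φ = P' := by
  obtain ⟨T, hT⟩ := (h.matrixMap ι).surjective P
  obtain ⟨U, hU⟩ := (h.matrixMap ι).surjective P'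
  obtain ⟨Z, hZ⟩ := (h.matrixMap ι).exists_eq_add (T * U) 1 (by rw [map_mul, hT, hU, hP, map_one])
  have hTU : T * (U * (1 - (p : Matrix ι ι W) * Z)) = 1 := by
    rw [← mul_assoc, hZ, add_mul, one_mul, mul_sub, mul_one, mul_assoc, ← mul_assoc Z,
      ← (Nat.cast_commute p Z).eq, mul_assoc, (h.matrixMap ι).mul_mul_eq_zero]
    abel
  refine ⟨T, _, hTU, mul_eq_one_comm.1 hTU, hT, ?_⟩
  change φ.mapMatrix _ = P'
  rw [map_mul, map_sub, (h.matrixMap ι).map_mul_eq_zero, hU, map_one, sub_zero, mul_one]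

/-- Multiplication matrices with respect to compatible bases are compatible. -/
theorem map_leftMulMatrix {ι S' S : Type*} [Fintype ι] [DecidableEq ι]
    [CommRing S'] [Algebra W S'] [CommRing S] [Algebra k S] (b' : Module.Basis ι W S')
    (b : Module.Basis ι k S) (Θ : S' →+* S) (hb : ∀ i, Θ (b' i) = b i)
    (hφ : ∀ (w : W) x, Θ (w • x) = φ w • Θ x) (x : S') :
    (Algebra.leftMulMatrix b' x).map φ = Algebra.leftMulMatrix b (Θ x) := by
  have hrepr : ∀ y i, φ (b'.repr y i) = b.repr (Θ y) i := by
    intro y i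
    conv_rhs => rw [← b'.sum_repr y, map_sum]
    simp only [hφ, hb, b.repr_sum_self]
  ext i j
  rw [Matrix.map_apply, Algebra.leftMulMatrix_eq_repr_mul, Algebra.leftMulMatrix_eq_repr_mul,
    hrepr, map_mul, hb]

theorem exists_matrix_of_basis (h : IsModPReduction p φ) {ι S' S : Type*} [Fintype ι]
    [CommRing S'] [Algebra W S'] [CommRing S] [Algebra k S] (b' : Module.Basis ι W S')
    (b : Module.Basis ι k S) (Θ : S' →+* S) (hb : ∀ i, Θ (b' i) = b i)
    (hφ : ∀ (w : W) x, Θ (w • x) = φ w • Θ x) {n M : ℕ} (A : Matrix (Fin n) (Fin n) k)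
    (E : (Fin n → k) ≃ₗ[k] S) {x : S'} (hE : ∀ v, E (A.mulVec v) = Θ x * E v)
    (hx : x ^ M = 1) :
    ∃ B : Matrix (Fin n) (Fin n) W, B ^ M = 1 ∧ B.map φ = A := by
  classical
  let c : Module.Basis (Fin n) k S := (Pi.basisFun k (Fin n)).map E
  let σ : ι ≃ Fin n := b.indexEquiv c
  have hA : A = Algebra.leftMulMatrix c (Θ x) := by
    ext i j
    have := congrFun (congrArg E.symm (hE (Pi.single j 1))) i
    rw [E.symm_apply_apply, Matrix.mulVec_single_one] at this
    rw [Algebra.leftMulMatrix_eq_repr_mul]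
    simpa [c] using this
  obtain ⟨T, T', hT, hT', hTφ, hTφ'⟩ := h.exists_mul_eq_one
    (c.toMatrix_mul_toMatrix_flip (b.reindex σ))
  refine ⟨T * Algebra.leftMulMatrix (b'.reindex σ) x * T', ?_, ?_⟩
  · have : ∀ m : ℕ, (T * Algebra.leftMulMatrix (b'.reindex σ) x * T') ^ m =
        T * Algebra.leftMulMatrix (b'.reindex σ) x ^ m * T' := by
      intro m
      induction m with
      | zero => simp [hT]
      | succ m ih =>
        rw [pow_succ, ih, pow_succ]
        simp only [mul_assoc]
        rw [← mul_assoc T' T, hT', one_mul]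
    rw [this, ← map_pow, hx, map_one, mul_one, hT]
  · rw [Matrix.map_mul, Matrix.map_mul, hTφ, hTφ', map_leftMulMatrix
      (b'.reindex σ) (b.reindex σ) Θ (by simp [hb]) hφ, Algebra.leftMulMatrix_apply,
      basis_toMatrix_mul_linearMap_toMatrix_mul_basis_toMatrix, hA, Algebra.leftMulMatrix_apply]

end IsModPReduction

theorem Polynomial.Monic.exists_basis_adjoinRoot {R : Type*} [CommRing R] {g : Polynomial R}
    (hg : g.Monic) {d : ℕ} (hd : g.natDegree = d) :
    ∃ b : Module.Basis (Fin d) R (AdjoinRoot g), ∀ j, b j = AdjoinRoot.root g ^ (j : ℕ) := by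
  subst hd
  exact ⟨(AdjoinRoot.powerBasis' hg).basis, fun j => (AdjoinRoot.powerBasis' hg).basis_eq_pow j⟩

open Polynomial in
theorem IsModPReduction.exists_matrix_pow_eq_one {p : ℕ} {W k : Type} [CommRing W] [Field k]
    {φ : W →+* k} (h : IsModPReduction p φ) (hp : p.Prime) [CharP k p] {m N : ℕ} (hN : ¬ p ∣ N)
    (hm : m = 0 ∨ ∀ r ≤ p ^ m, r ≤ p ^ (m - 1) ∨ p ^ m - r ≤ p ^ (m - 1)) {n : ℕ}
    (A : Matrix (Fin n) (Fin n) k) (hA : A ^ (p ^ m * N) = 1) :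
    ∃ B : Matrix (Fin n) (Fin n) W, B ^ (p ^ m * N) = 1 ∧ B.map φ = A := by
  classical
  obtain ⟨ι, _, f, hf, E, hE⟩ := A.exists_linearEquiv_adjoinRoot
  have hEpow : ∀ (M : ℕ) v, E ((A ^ M).mulVec v) = (fun i => AdjoinRoot.root (f i)) ^ M * E v := by
    intro M
    induction M with
    | zero => simp
    | succ M ih =>
      intro v
      rw [pow_succ, ← Matrix.mulVec_mulVec, ih, hE, ← mul_assoc, ← pow_succ]
  have hdvd : ∀ i, f i ∣ X ^ (p ^ m * N) - 1 := by
    intro i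
    have := congrFun (hEpow (p ^ m * N) (E.symm 1)) i
    rw [hA, Matrix.one_mulVec, E.apply_symm_apply, mul_one] at this
    rw [← AdjoinRoot.mk_eq_zero, map_sub, map_pow, AdjoinRoot.mk_X, map_one, sub_eq_zero]
    exact this.symm
  have hlift : ∀ i, ∃ Q : W[X], Q.Monic ∧ Q.map φ = f i ∧ Q ∣ X ^ (p ^ m * N) - 1 := by
    intro i
    obtain ⟨q, r, hq, hqi, hi⟩ := hf i
    rw [hi]
    exact h.exists_monic_dvd_X_pow_sub_one hp hN hm hq hqi (hi ▸ hdvd i)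
  choose Q hQ hQf hQdvd using hlift
  obtain rfl : (fun i => (Q i).map φ) = f := funext hQf
  have := φ.domain_nontrivial
  choose b' hb' using fun i => (hQ i).exists_basis_adjoinRoot rfl
  choose b hb using fun i => ((hQ i).map φ).exists_basis_adjoinRoot ((hQ i).natDegree_map φ)
  let Θ : (Π i, AdjoinRoot (Q i)) →+* Π i, AdjoinRoot ((Q i).map φ) :=
    RingHom.pi fun i => (AdjoinRoot.map φ (Q i) _ dvd_rfl).comp (Pi.evalRingHom _ i)
  have hΘ : ∀ x i, Θ x i = AdjoinRoot.map φ (Q i) _ dvd_rfl (x i) := fun _ _ => rfl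
  refine h.exists_matrix_of_basis
    (Pi.basis b') (Pi.basis b) Θ ?_ ?_ A E (x := fun i => AdjoinRoot.root (Q i)) ?_ ?_
  · rintro ⟨i, j⟩
    ext l
    by_cases hl : l = i
    · subst hl
      simp [hΘ, hb, hb']
    · simp [hΘ, hl]
  · intro w x
    ext i
    rw [hΘ, Pi.smul_apply, Pi.smul_apply, hΘ, Algebra.smul_def, Algebra.smul_def, map_mul]
    congr 1
    exact AdjoinRoot.map_of φ (Q i) _ dvd_rfl w
  · intro v
    rw [hE]
    congr 1
    ext i
    rw [hΘ, AdjoinRoot.map_root]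
  · ext i
    rw [Pi.pow_apply, Pi.one_apply, ← sub_eq_zero, ← AdjoinRoot.mk_X, ← map_pow,
      ← map_one (AdjoinRoot.mk _), ← map_sub, AdjoinRoot.mk_eq_zero]
    exact hQdvd i

theorem IsCyclic.hasLp {G : Type*} [Group G] [IsCyclic G] {p : ℕ} [hp : Fact p.Prime] {m N : ℕ}
    (hG : Nat.card G = p ^ m * N) (hN : ¬ p ∣ N)
    (hm : m = 0 ∨ ∀ r ≤ p ^ m, r ≤ p ^ (m - 1) ∨ p ^ m - r ≤ p ^ (m - 1)) : HasLp p G := by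
  intro n _ k _ _ _ f
  obtain ⟨σ, hσ⟩ := IsCyclic.exists_generator (α := G)
  have hcard : Nat.card G ≠ 0 := by
    rw [hG]
    exact mul_ne_zero (pow_ne_zero _ hp.out.ne_zero) fun h => hN (h ▸ dvd_zero p)
  obtain ⟨B, hB, hBA⟩ := (isModPReduction_wittReduce p k).exists_matrix_pow_eq_one hp.out hN hm
    (f σ : Matrix (Fin n) (Fin n) k) (by
      rw [← hG, ← Units.val_pow_eq_pow_val, ← map_pow, pow_card_eq_one', map_one, Units.val_one])
  rw [← hG] at hB
  let u : GL (Fin n) (TruncatedWittVector p 2 k) := Units.ofPowEqOne B _ hB hcard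
  have hu : orderOf u ∣ orderOf σ := by
    rw [orderOf_eq_card_of_forall_mem_zpowers hσ]
    exact orderOf_dvd_of_pow_eq_one (Units.pow_ofPowEqOne hB hcard)
  refine ⟨monoidHomOfForallMemZpowers hσ hu, ?_⟩
  rw [MonoidHom.eq_iff_eq_on_generator hσ, MonoidHom.comp_apply,
    monoidHomOfForallMemZpowers_apply_gen]
  ext i j
  exact congrFun₂ hBA i j

theorem IsCyclic.hasL_of_card {G : Type*} [Group G] [IsCyclic G] {n : ℕ}
    (hG : Nat.card G = 2 ^ n ∨ Nat.card G = 3 * 2 ^ n) : HasL G := by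
  intro p hp
  have h2 : n = 0 ∨ ∀ r ≤ 2 ^ n, r ≤ 2 ^ (n - 1) ∨ 2 ^ n - r ≤ 2 ^ (n - 1) := by
    rcases n with _ | n
    · exact Or.inl rfl
    · refine Or.inr fun r _ => ?_
      rw [Nat.add_sub_cancel, pow_succ]
      omega
  rcases eq_or_ne p 2 with rfl | hp2
  · rcases hG with hG | hG
    · exact IsCyclic.hasLp (N := 1) (by rw [hG, mul_one]) (by norm_num) h2
    · exact IsCyclic.hasLp (N := 3) (by rw [hG, mul_comm]) (by norm_num) h2
  have hp2n : ¬ p ∣ 2 ^ n := fun h =>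
    hp2 ((Nat.prime_dvd_prime_iff_eq hp.out Nat.prime_two).1 (hp.out.dvd_of_dvd_pow h))
  rcases hG with hG | hG
  · exact IsCyclic.hasLp (m := 0) (by rw [hG, pow_zero, one_mul]) hp2n (Or.inl rfl)
  rcases eq_or_ne p 3 with rfl | hp3
  · exact IsCyclic.hasLp (m := 1) (by rw [hG, pow_one]) hp2n
      (Or.inr fun r _ => by simp only [pow_one, Nat.sub_self, pow_zero]; omega)
  · refine IsCyclic.hasLp (m := 0) (N := 3 * 2 ^ n) (by rw [hG, pow_zero, one_mul]) ?_ (Or.inl rfl)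
    rw [hp.out.dvd_mul, Nat.prime_dvd_prime_iff_eq hp.out Nat.prime_three]
    tauto

/-- a finite abelian group has property `L` iff it is cyclic of order `2^n`
or of order `3·2^n` for some `n ≥ 0`. -/
theorem abelian_hasL_iff (G : Type*) [CommGroup G] [Finite G] :
    HasL G ↔ (IsCyclic G ∧ ∃ n : ℕ, Nat.card G = 2 ^ n ∨ Nat.card G = 3 * 2 ^ n) := by
  refine ⟨fun h => h.isCyclic_and_card, ?_⟩
  rintro ⟨_, n, hn⟩
  exact IsCyclic.hasL_of_card hn
end

section
/- Let k be a field of characteristic p > 0, let G be a finite p-group which is not cyclic, and let (V, ρ) be a nonzero finite-dimensional representation of G over k such that some g ∈ G acts on V as a single Jordan block, i.e., the kernel of ρ(g) − id_V is a one-dimensional k-subspace of V (note that ρ(g) − id_V is automatically nilpotent since g has p-power order and k has characteristic p). Then the first group cohomology H¹(G, V) is nonzero. -/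
universe u

open Module in
theorem LinearMap.finrank_le_finrank_range_pow_add {k V : Type*} [Field k] [AddCommGroup V]
    [Module k V] [FiniteDimensional k V] (f : Module.End k V) (m : ℕ) :
    finrank k V ≤ finrank k (LinearMap.range (f ^ m)) + m * finrank k (LinearMap.ker f) := by
  induction m with
  | zero =>
    have h : LinearMap.range (f ^ 0) = ⊤ := by
      rw [pow_zero, Module.End.one_eq_id, LinearMap.range_id]
    rw [h, finrank_top, zero_mul, add_zero]
  | succ m ih =>
    have hrange : LinearMap.range (f ^ (m + 1)) =
        LinearMap.range (f.domRestrict (LinearMap.range (f ^ m))) := by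
      rw [LinearMap.range_domRestrict, pow_succ', Module.End.mul_eq_comp, LinearMap.range_comp]
    have hker : finrank k (LinearMap.ker (f.domRestrict (LinearMap.range (f ^ m)))) ≤
        finrank k (LinearMap.ker f) := by
      rw [← Submodule.finrank_map_subtype_eq]
      refine Submodule.finrank_mono ?_
      rintro _ ⟨x, hx, rfl⟩
      exact hx
    have := (f.domRestrict (LinearMap.range (f ^ m))).finrank_range_add_finrank_ker
    rw [hrange]
    linarith

namespace Representation

/-- A finite `p`-group acting linearly on a nonzero vector space of characteristic `p` fixes a nonzero
vector. -/
theorem exists_ne_zero_forall_apply_eq (p : ℕ) [Fact p.Prime] {k G V : Type*} [Field k]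
    [CharP k p] [Group G] [Finite G] (hG : IsPGroup p G) [AddCommGroup V] [Module k V]
    [Nontrivial V] (ρ : Representation k G V) : ∃ v ≠ 0, ∀ g, ρ g v = v := by
  let := ZMod.algebra k p
  let := Module.compHom V (algebraMap (ZMod p) k)
  obtain ⟨v, hv⟩ := exists_ne (0 : V)
  let S : AddSubgroup V := (Submodule.span (ZMod p) (Set.range fun g ↦ ρ g v)).toAddSubgroup
  have : Module.Finite (ZMod p) (Submodule.span (ZMod p) (Set.range fun g ↦ ρ g v)) :=
    Module.Finite.span_of_finite _ (Set.finite_range _)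
  have : Finite S :=
    Module.finite_of_finite (ZMod p) (M := Submodule.span (ZMod p) (Set.range fun g ↦ ρ g v))
  have hvS : v ∈ S := Submodule.subset_span ⟨1, by simp⟩
  have hS (g : G) (w : V) (hw : w ∈ S) : ρ g w ∈ S := by
    refine Submodule.span_induction (p := fun w _ ↦ ρ g w ∈ S) ?_ ?_ ?_ ?_ hw
    · rintro _ ⟨h, rfl⟩
      exact Submodule.subset_span ⟨g * h, by simp⟩
    · simp
    · intro x y _ _ hx hy
      simpa using add_mem hx hy
    · intro a x _ hx
      change ρ g (algebraMap (ZMod p) k a • x) ∈ S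
      rw [map_smul]
      exact Submodule.smul_mem _ a hx
  let : MulAction G S :=
    { smul := fun g w ↦ ⟨ρ g w, hS g w w.2⟩
      one_smul := fun w ↦ Subtype.ext (by change ρ 1 (w : V) = w; simp)
      mul_smul := fun g h w ↦ Subtype.ext (by change ρ (g * h) (w : V) = ρ g (ρ h w); simp) }
  have hdvd : p ∣ Nat.card S := by
    have hord : addOrderOf (⟨v, hvS⟩ : S) = p := by
      refine addOrderOf_eq_prime (Subtype.ext ?_) fun h ↦ hv (congrArg Subtype.val h)
      change p • v = 0
      rw [← Nat.cast_smul_eq_nsmul k, CharP.cast_eq_zero, zero_smul]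
    exact hord ▸ addOrderOf_dvd_natCard _
  obtain ⟨b, hb, hb0⟩ := hG.exists_fixed_point_of_prime_dvd_card_of_fixed_point S hdvd
    (a := 0) fun g ↦ Subtype.ext (map_zero (ρ g))
  exact ⟨b, fun h ↦ hb0 (Subtype.ext h.symm), fun g ↦ congrArg Subtype.val (hb g)⟩

/-- The right regular representation on functions. -/
def funRightRegular (k G : Type*) [CommSemiring k] [Monoid G] : Representation k G (G → k) where
  toFun g := LinearMap.funLeft k k (· * g)
  map_one' := by ext; simp
  map_mul' _ _ := by ext; simp [mul_assoc, LinearMap.funLeft_apply]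

@[simp]
theorem funRightRegular_apply {k G : Type*} [CommSemiring k] [Monoid G] (g : G) (f : G → k)
    (x : G) : funRightRegular k G g f x = f (x * g) :=
  rfl

/-- The matrix coefficient map `v ↦ (x ↦ l (ρ x v))` of a linear functional `l`. -/
def matrixCoeff {k G V : Type*} [CommSemiring k] [Monoid G] [AddCommMonoid V] [Module k V]
    (ρ : Representation k G V) (l : Module.Dual k V) : V →ₗ[k] G → k :=
  LinearMap.pi fun x ↦ l ∘ₗ ρ x

@[simp]
theorem matrixCoeff_apply {k G V : Type*} [CommSemiring k] [Monoid G] [AddCommMonoid V]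
    [Module k V] (ρ : Representation k G V) (l : Module.Dual k V) (v : V) (x : G) :
    ρ.matrixCoeff l v x = l (ρ x v) :=
  rfl

theorem matrixCoeff_map {k G V : Type*} [CommSemiring k] [Monoid G] [AddCommMonoid V]
    [Module k V] (ρ : Representation k G V) (l : Module.Dual k V) (g : G) (v : V) :
    ρ.matrixCoeff l (ρ g v) = funRightRegular k G g (ρ.matrixCoeff l v) := by
  ext x
  simp

/-- If the invariants of a `p`-group representation in characteristic `p` are spanned by `u`, then
matrix coefficients against a functional not vanishing on `u` embed it in the regular
representation. -/
theorem matrixCoeff_injective (p : ℕ) [Fact p.Prime] {k G V : Type*} [Field k]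
    [CharP k p] [Group G] [Finite G] (hG : IsPGroup p G) [AddCommGroup V] [Module k V]
    (ρ : Representation k G V) {u : V} (hu : ∀ v, (∀ g, ρ g v = v) → ∃ c : k, c • u = v)
    (l : Module.Dual k V) (hl : l u ≠ 0) : Function.Injective (ρ.matrixCoeff l) := by
  rw [← LinearMap.ker_eq_bot]
  by_contra hne
  have : Nontrivial (LinearMap.ker (ρ.matrixCoeff l)) := Submodule.nontrivial_iff_ne_bot.mpr hne
  obtain ⟨⟨v, hv⟩, hv0, hfix⟩ := (ρ.subrepresentation (LinearMap.ker (ρ.matrixCoeff l))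
    fun g v hv ↦ by
      rw [Submodule.mem_comap, LinearMap.mem_ker, matrixCoeff_map, LinearMap.mem_ker.mp hv,
        map_zero]).exists_ne_zero_forall_apply_eq p hG
  obtain ⟨c, rfl⟩ := hu v fun g ↦ congrArg Subtype.val (hfix g)
  have hc : c * l u = 0 := by simpa using congrFun (LinearMap.mem_ker.mp hv) 1
  obtain rfl := (mul_eq_zero.mp hc).resolve_right hl
  exact hv0 (Subtype.ext (zero_smul k u))

/-- If every `1`-cocycle of a `p`-group representation in characteristic `p` is a coboundary, then
an injective matrix coefficient map against a functional not vanishing on some invariant is onto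
the regular representation. -/
theorem matrixCoeff_surjective (p : ℕ) [Fact p.Prime] {k G V : Type*} [Field k]
    [CharP k p] [Group G] [Finite G] (hG : IsPGroup p G) [AddCommGroup V] [Module k V]
    (ρ : Representation k G V) {u : V} (hu : ∀ g, ρ g u = u)
    (l : Module.Dual k V) (hl : l u ≠ 0) (hinj : Function.Injective (ρ.matrixCoeff l))
    (hρ : ∀ f : G → V, (∀ g h, f (g * h) = ρ g (f h) + f g) → ∃ v, ∀ g, ρ g v - v = f g) :
    Function.Surjective (ρ.matrixCoeff l) := by
  rw [← LinearMap.range_eq_top]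
  by_contra hne
  have : Nontrivial ((G → k) ⧸ LinearMap.range (ρ.matrixCoeff l)) :=
    Submodule.Quotient.nontrivial_iff.mpr hne
  have hstable (g : G) : LinearMap.range (ρ.matrixCoeff l) ≤
      (LinearMap.range (ρ.matrixCoeff l)).comap (funRightRegular k G g) := by
    rintro _ ⟨v, rfl⟩
    exact ⟨ρ g v, matrixCoeff_map ρ l g v⟩
  obtain ⟨q, hq0, hq⟩ :=
    ((funRightRegular k G).quotient _ hstable).exists_ne_zero_forall_apply_eq p hG
  obtain ⟨w, rfl⟩ := Submodule.Quotient.mk_surjective _ q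
  have hw (g : G) : ∃ v, ρ.matrixCoeff l v = funRightRegular k G g w - w :=
    (Submodule.Quotient.eq _).mp (hq g)
  choose f hf using hw
  obtain ⟨v, hv⟩ := hρ f fun g h ↦ hinj <| by
    rw [map_add, matrixCoeff_map, hf, hf, hf, map_mul, map_sub, Module.End.mul_apply]
    abel
  have hinv (g : G) : w g - ρ.matrixCoeff l v g = w 1 - ρ.matrixCoeff l v 1 := by
    have h := congrFun (hf g) 1
    rw [← hv, map_sub, matrixCoeff_map] at h
    simp only [Pi.sub_apply, funRightRegular_apply, one_mul] at h
    linear_combination -h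
  refine hq0 ((Submodule.Quotient.mk_eq_zero _).mpr
    ⟨v + ((w 1 - ρ.matrixCoeff l v 1) / l u) • u, funext fun g ↦ ?_⟩)
  rw [map_add, map_smul, Pi.add_apply, Pi.smul_apply, matrixCoeff_apply ρ l u, hu, smul_eq_mul,
    div_mul_cancel₀ _ hl, ← hinv g]
  ring

/-- An element of a `p`-group acting by a single Jordan block in characteristic `p` has
order at least the dimension of the representation. -/
theorem finrank_le_orderOf (p : ℕ) [Fact p.Prime] {k G V : Type*} [Field k]
    [CharP k p] [Group G] (hG : IsPGroup p G) [AddCommGroup V] [Module k V]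
    [FiniteDimensional k V] [Nontrivial V] (ρ : Representation k G V) (g : G)
    (hg : Module.finrank k (LinearMap.ker (ρ g - LinearMap.id)) = 1) :
    Module.finrank k V ≤ orderOf g := by
  have : CharP (Module.End k V) p :=
    charP_of_injective_algebraMap (algebraMap k (Module.End k V)).injective p
  obtain ⟨n, hn⟩ := IsPGroup.iff_orderOf.mp hG g
  have hpow : (ρ g - LinearMap.id) ^ orderOf g = 0 := by
    rw [hn, ← Module.End.one_eq_id, sub_pow_char_pow_of_commute _ _ (Commute.one_right _), ← hn,
      ← map_pow, pow_orderOf_eq_one, map_one, one_pow, sub_self]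
  have h := LinearMap.finrank_le_finrank_range_pow_add (ρ g - LinearMap.id) (orderOf g)
  rwa [hpow, LinearMap.range_zero, finrank_bot, hg, zero_add, mul_one] at h

end Representation

theorem groupCohomology.exists_of_subsingleton_H1 {k G V : Type u} [CommRing k] [Group G]
    [AddCommGroup V] [Module k V] (ρ : Representation k G V)
    [Subsingleton (groupCohomology.H1 (Rep.of ρ))] (f : G → V)
    (hf : ∀ g h, f (g * h) = ρ g (f h) + f g) : ∃ v, ∀ g, ρ g v - v = f g := by
  have hmem : f ∈ cocycles₁ (Rep.of ρ) := (mem_cocycles₁_iff (A := Rep.of ρ) f).mpr hf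
  obtain ⟨v, hv⟩ := (H1π_eq_zero_iff (⟨f, hmem⟩ : cocycles₁ (Rep.of ρ))).mp
    (Subsingleton.elim _ _)
  exact ⟨v, congrFun hv⟩

/-- if `G` is a non-cyclic finite `p`-group, `k` has characteristic `p`, and
`(V, ρ)` is a nonzero finite-dimensional representation of `G` over `k` in which some `g`
acts as a single Jordan block (i.e. `ker (ρ(g) - 1)` is one-dimensional), then
`H¹(G, V) ≠ 0`. -/
theorem h1_nontrivial_of_single_jordan_block (p : ℕ) [Fact p.Prime] (k G V : Type u)
    [Field k] [CharP k p] [Group G] [Finite G] (hG : IsPGroup p G) (hnc : ¬ IsCyclic G)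
    [AddCommGroup V] [Module k V] [FiniteDimensional k V] [Nontrivial V]
    (ρ : Representation k G V) (g : G)
    (hg : Module.finrank k ↥(LinearMap.ker (ρ g - (LinearMap.id : V →ₗ[k] V))) = 1) :
    Nontrivial (groupCohomology.H1 (Rep.of ρ)) := by
  rw [← not_subsingleton_iff_nontrivial]
  intro _
  obtain ⟨u, hu0, hu⟩ := ρ.exists_ne_zero_forall_apply_eq p hG
  have hspan (v : V) (hv : ∀ g, ρ g v = v) : ∃ c : k, c • u = v := by
    obtain ⟨c, hc⟩ := (finrank_eq_one_iff_of_nonzero'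
      (⟨u, by simp [hu]⟩ : LinearMap.ker (ρ g - (LinearMap.id : V →ₗ[k] V)))
      fun h ↦ hu0 (congrArg Subtype.val h)).mp hg ⟨v, by simp [hv]⟩
    exact ⟨c, congrArg Subtype.val hc⟩
  obtain ⟨l, hl⟩ := not_forall.mp ((Module.forall_dual_apply_eq_zero_iff k u).not.mpr hu0)
  have hinj := ρ.matrixCoeff_injective p hG hspan l hl
  have hsurj := ρ.matrixCoeff_surjective p hG hu l hl hinj
    (groupCohomology.exists_of_subsingleton_H1 ρ)
  have := Fintype.ofFinite G
  have hdim := (LinearEquiv.ofBijective _ ⟨hinj, hsurj⟩).finrank_eq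
  rw [Module.finrank_fintype_fun_eq_card, ← Nat.card_eq_fintype_card] at hdim
  exact hnc (isCyclic_of_orderOf_eq_card g
    (le_antisymm orderOf_le_card (hdim ▸ ρ.finrank_le_orderOf p hG g hg)))
end
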